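/- Let G be a finite group. (1) If H ≤ G is a subgroup and ρ ∈ P_H, then Ind_H^G ρ ∈ P_G. (2) If N is a normal subgroup of G, then inflation of characters along the quotient map G → G/N maps S_{G/N} into S_G and maps P_{G/N} into P_G. -/

import Mathlib

open scoped BigOperators

noncomputable section

namespace Chars

/-- The permutation character `Ind_H^G 1` of `G` acting on the cosets `G ⧸ H`:
`g` is sent to the number of fixed points of `g` on `G ⧸ H`. -/
def permChar {G : Type} [Group G] (H : Subgroup G) : G → ℂ :=
  fun g => (Nat.card {x : G ⧸ H // g • x = x} : ℂ)

open scoped Classical in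
/-- The class function on `G` induced from a class function `f` on a subgroup `H`. -/
def indChar {G : Type} [Group G] [Finite G] (H : Subgroup G) (f : ↥H → ℂ) : G → ℂ :=
  fun g => (Nat.card ↥H : ℂ)⁻¹ *
    ∑ᶠ x : G, if h : x⁻¹ * g * x ∈ H then f ⟨x⁻¹ * g * x, h⟩ else 0

/-- The determinant character of a finite dimensional complex representation. -/
def detChar {G : Type} [Group G] (V : FDRep ℂ G) : G → ℂ :=
  fun g => LinearMap.det (V.ρ g)

/-- `χ` is a permutation (virtual) character: a `ℤ`-linear combination of the
characters `Ind_H^G 1` of permutation representations. -/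
def IsPermChar {G : Type} [Group G] (χ : G → ℂ) : Prop :=
  ∃ (k : ℕ) (Hs : Fin k → Subgroup G) (ns : Fin k → ℤ),
    χ = fun g => ∑ i, (ns i : ℂ) * permChar (Hs i) g

/-- `χ` is a virtual character: a difference of two genuine characters. -/
def IsVirtualChar {G : Type} [Group G] (χ : G → ℂ) : Prop :=
  ∃ V W : FDRep ℂ G, χ = V.character - W.character

/-- The virtual character `χ` has trivial determinant:  writing `χ = χ_V - χ_W`, the
determinant characters of `V` and `W` agree.  (The determinant of a virtual character
is well defined, so this does not depend on the choice of decomposition.) -/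
def HasTrivialDet {G : Type} [Group G] (χ : G → ℂ) : Prop :=
  ∃ V W : FDRep ℂ G, χ = V.character - W.character ∧ ∀ g, detChar V g = detChar W g

/-- The set `S_G` of permutation characters of `G` of degree `0` with trivial
determinant. -/
def MemS {G : Type} [Group G] (χ : G → ℂ) : Prop :=
  IsPermChar χ ∧ χ 1 = 0 ∧ HasTrivialDet χ

/-- The set `P_G`: the smallest set of (real valued) characters of `G` containing
`τ + τ̄` for every virtual character `τ` of degree `0`, containing
`Ind_H^G (τ - 1 - det τ)` for every subgroup `H ≤ G` and every degree `2` character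
`τ` of `H` factoring through a quotient of `H` isomorphic to `C₂ × C₂`, `D₈` or
`D_{2p}` (`p` an odd prime), and closed under `ℤ`-linear combinations. -/
inductive MemP (G : Type) [Group G] [Finite G] : (G → ℂ) → Prop where
  | selfConj (V W : FDRep ℂ G) (hdeg : V.character 1 = W.character 1) :
      MemP G ((V.character - W.character) + star (V.character - W.character))
  | dihedralInd (H : Subgroup G) (τ : FDRep ℂ ↥H) (hdeg : τ.character 1 = 2)
      (N : Subgroup ↥H) [hN : N.Normal]
      (hfac : ∀ n h : ↥H, n ∈ N → τ.character (n * h) = τ.character h)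
      (hquot : Nonempty (↥H ⧸ N ≃* Multiplicative (ZMod 2) × Multiplicative (ZMod 2)) ∨
               Nonempty (↥H ⧸ N ≃* DihedralGroup 4) ∨
               ∃ p : ℕ, p.Prime ∧ Odd p ∧ Nonempty (↥H ⧸ N ≃* DihedralGroup p)) :
      MemP G (indChar H (τ.character - 1 - detChar τ))
  | zero : MemP G 0
  | add {χ ψ : G → ℂ} : MemP G χ → MemP G ψ → MemP G (χ + ψ)
  | zsmul (n : ℤ) {χ : G → ℂ} : MemP G χ → MemP G (n • χ)

end Chars
namespace Chars

open scoped Classical in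
/-- Extension by zero of a function on a subgroup to the whole group. -/
def extendZero {G : Type} [Group G] (H : Subgroup G) (f : ↥H → ℂ) : G → ℂ :=
  fun g => if h : g ∈ H then f ⟨g, h⟩ else 0

section ClassFunctions

variable {G : Type} [Group G]

@[simp]
lemma extendZero_coe (H : Subgroup G) (f : ↥H → ℂ) (h : ↥H) : extendZero H f h = f h := by
  simp [extendZero]

lemma extendZero_of_notMem (H : Subgroup G) (f : ↥H → ℂ) {g : G} (hg : g ∉ H) :
    extendZero H f g = 0 := by
  simp [extendZero, hg]

lemma extendZero_add (H : Subgroup G) (f f' : ↥H → ℂ) (g : G) :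
    extendZero H (f + f') g = extendZero H f g + extendZero H f' g := by
  by_cases h : g ∈ H <;> simp [extendZero, h]

lemma extendZero_zsmul (H : Subgroup G) (n : ℤ) (f : ↥H → ℂ) (g : G) :
    extendZero H (n • f) g = n * extendZero H f g := by
  by_cases h : g ∈ H <;> simp [extendZero, h]

lemma extendZero_star (H : Subgroup G) (f : ↥H → ℂ) (g : G) :
    extendZero H (star f) g = star (extendZero H f g) := by
  by_cases h : g ∈ H <;> simp [extendZero, h]

lemma indChar_apply [Fintype G] (H : Subgroup G) (f : ↥H → ℂ) (g : G) :
    indChar H f g = (Nat.card ↥H : ℂ)⁻¹ * ∑ x : G, extendZero H f (x⁻¹ * g * x) := by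
  rw [indChar, finsum_eq_sum_of_fintype]
  rfl

variable [Finite G]

lemma indChar_add (H : Subgroup G) (f f' : ↥H → ℂ) :
    indChar H (f + f') = indChar H f + indChar H f' := by
  have := Fintype.ofFinite G
  ext g
  simp only [indChar_apply, Pi.add_apply, extendZero_add, Finset.sum_add_distrib, mul_add]

lemma indChar_zsmul (H : Subgroup G) (n : ℤ) (f : ↥H → ℂ) :
    indChar H (n • f) = n • indChar H f := by
  have := Fintype.ofFinite G
  ext g
  simp only [indChar_apply, Pi.smul_apply, extendZero_zsmul, ← Finset.mul_sum]
  rw [zsmul_eq_mul]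
  ring

lemma indChar_zero (H : Subgroup G) : indChar H (0 : ↥H → ℂ) = 0 := by
  simpa using indChar_zsmul H 0 (0 : ↥H → ℂ)

lemma indChar_sub (H : Subgroup G) (f f' : ↥H → ℂ) :
    indChar H (f - f') = indChar H f - indChar H f' := by
  have h : f - f' = f + (-1 : ℤ) • f' := by simp [sub_eq_add_neg]
  rw [h, indChar_add, indChar_zsmul]
  simp [sub_eq_add_neg]

lemma indChar_star (H : Subgroup G) (f : ↥H → ℂ) : indChar H (star f) = star (indChar H f) := by
  have := Fintype.ofFinite G
  ext g
  simp [indChar_apply, extendZero_star]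

lemma indChar_one (H : Subgroup G) (f : ↥H → ℂ) :
    indChar H f 1 = (Nat.card ↥H : ℂ)⁻¹ * (Nat.card G * f 1) := by
  have := Fintype.ofFinite G
  have h : extendZero H f 1 = f 1 := extendZero_coe H f 1
  simp [indChar_apply, h]

/-- Transitivity of induction. -/
lemma indChar_indChar (H : Subgroup G) (K : Subgroup ↥H) (f : ↥K → ℂ) :
    indChar H (indChar K f) = indChar (K.map H.subtype)
      (f ∘ (K.equivMapOfInjective H.subtype H.subtype_injective).symm) := by
  have := Fintype.ofFinite G
  have := Fintype.ofFinite ↥H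
  set e := K.equivMapOfInjective H.subtype H.subtype_injective
  set F := extendZero (K.map H.subtype) (f ∘ e.symm)
  have hK (z : ↥H) : extendZero K f z = F z := by
    by_cases hz : z ∈ K
    · have h₁ := extendZero_coe K f ⟨z, hz⟩
      have h₂ := extendZero_coe (K.map H.subtype) (f ∘ e.symm) (e ⟨z, hz⟩)
      rw [Function.comp_apply, e.symm_apply_apply] at h₂
      exact h₁.trans h₂.symm
    · rw [extendZero_of_notMem _ _ hz]
      refine (extendZero_of_notMem _ _ ?_).symm
      simpa using hz
  have hH (z : G) : extendZero H (indChar K f) z =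
      (Nat.card ↥K : ℂ)⁻¹ * ∑ y : ↥H, F ((y : G)⁻¹ * z * y) := by
    by_cases hz : z ∈ H
    · refine (extendZero_coe H (indChar K f) ⟨z, hz⟩).trans ?_
      simp [indChar_apply, hK]
    · rw [extendZero_of_notMem _ _ hz, Finset.sum_eq_zero, mul_zero]
      intro y _
      apply extendZero_of_notMem
      intro h
      obtain ⟨w, -, hw⟩ := h
      apply hz
      have hz' : z = y * w * (y : G)⁻¹ := by
        have : (w : G) = (y : G)⁻¹ * z * y := hw
        rw [this]; group
      rw [hz']
      exact H.mul_mem (H.mul_mem y.2 w.2) (H.inv_mem y.2)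
  have hcard : Nat.card ↥(K.map H.subtype) = Nat.card ↥K := Nat.card_congr e.symm.toEquiv
  have hHne : (Nat.card ↥H : ℂ) ≠ 0 := Nat.cast_ne_zero.2 Nat.card_pos.ne'
  ext g
  have hsum (y : ↥H) : ∑ x : G, F ((y : G)⁻¹ * (x⁻¹ * g * x) * y) = ∑ x : G, F (x⁻¹ * g * x) := by
    rw [← Equiv.sum_comp (Equiv.mulRight (y : G)) (fun x : G => F (x⁻¹ * g * x))]
    simp [mul_assoc]
  rw [indChar_apply, indChar_apply, hcard]
  simp_rw [hH]
  rw [← Finset.mul_sum, Finset.sum_comm]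
  simp_rw [hsum]
  rw [Finset.sum_const, Finset.card_univ, nsmul_eq_mul, Fintype.card_eq_nat_card]
  field_simp
  rfl

/-- Induction commutes with pullback along a surjective homomorphism. -/
lemma indChar_comp_of_surjective {Q : Type} [Group Q] [Finite Q] (π : G →* Q)
    (hπ : Function.Surjective π) (H : Subgroup Q) (f : ↥H → ℂ) :
    indChar H f ∘ π = indChar (H.comap π) (f ∘ π.subgroupComap H) := by
  have := Fintype.ofFinite G
  have := Fintype.ofFinite Q
  have hext (z : G) :
      extendZero (H.comap π) (f ∘ π.subgroupComap H) z = extendZero H f (π z) := by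
    by_cases hz : π z ∈ H
    · exact (extendZero_coe (H.comap π) (f ∘ π.subgroupComap H) ⟨z, hz⟩).trans
        (extendZero_coe H f ⟨π z, hz⟩).symm
    · rw [extendZero_of_notMem _ _ hz, extendZero_of_notMem]
      simpa using hz
  have hfiber (F : Q → ℂ) : ∑ x : G, F (π x) = Nat.card π.ker * ∑ q : Q, F q := by
    classical
    rw [← Finset.sum_fiberwise Finset.univ π, Finset.mul_sum]
    refine Finset.sum_congr rfl fun q _ => ?_
    rw [Finset.sum_congr rfl (g := fun _ => F q) (by simp +contextual), Finset.sum_const,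
      nsmul_eq_mul]
    congr 2
    obtain ⟨a, rfl⟩ := hπ q
    rw [← Nat.card_congr (π.fiberEquivKer a), Nat.card_eq_fintype_card, Fintype.card_subtype]
    simp
  have hcard : (Nat.card ↥(H.comap π) : ℂ) = Nat.card π.ker * Nat.card ↥H := by
    have h₁ := (H.comap π).card_mul_index
    have h₂ := π.ker.card_mul_index
    rw [H.index_comap_of_surjective hπ] at h₁
    rw [Subgroup.index_ker, MonoidHom.range_eq_top_of_surjective π hπ, Subgroup.card_top,
      ← H.card_mul_index, ← mul_assoc, ← h₁] at h₂
    exact_mod_cast (Nat.eq_of_mul_eq_mul_right (Nat.pos_of_ne_zero H.index_ne_zero_of_finite)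
      h₂).symm
  have hker : (Nat.card π.ker : ℂ) ≠ 0 := Nat.cast_ne_zero.2 Nat.card_pos.ne'
  ext g
  simp only [Function.comp_apply, indChar_apply, hext, hcard, map_mul, map_inv]
  rw [hfiber (fun q => extendZero H f (q⁻¹ * π g * q)), mul_inv]
  field_simp

end ClassFunctions

/-- Restriction of a representation along a group homomorphism. -/
def resRep {G Q : Type} [Group G] [Group Q] (φ : G →* Q) (V : FDRep ℂ Q) : FDRep ℂ G :=
  FDRep.of (MonoidHom.comp V.ρ φ)

lemma character_resRep {G Q : Type} [Group G] [Group Q] (φ : G →* Q) (V : FDRep ℂ Q) :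
    (resRep φ V).character = V.character ∘ φ := rfl

lemma detChar_resRep {G Q : Type} [Group G] [Group Q] (φ : G →* Q) (V : FDRep ℂ Q) :
    detChar (resRep φ V) = detChar V ∘ φ := rfl

section Induction

variable {G : Type} [Group G] [Finite G]

lemma trace_pi {ι V : Type} [Fintype ι] [DecidableEq ι] [AddCommGroup V] [Module ℂ V]
    [FiniteDimensional ℂ V] (T : (ι → V) →ₗ[ℂ] (ι → V)) :
    LinearMap.trace ℂ (ι → V) T =
      ∑ i, LinearMap.trace ℂ V (LinearMap.proj i ∘ₗ T ∘ₗ LinearMap.single ℂ (fun _ => V) i) := by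
  have hT : T = ∑ i, (T ∘ₗ LinearMap.single ℂ (fun _ => V) i) ∘ₗ LinearMap.proj i := by
    refine LinearMap.ext fun f => ?_
    simp [← map_sum, Finset.univ_sum_single]
  conv_lhs => rw [hT]
  rw [map_sum]
  exact Finset.sum_congr rfl fun i _ => LinearMap.trace_comp_comm' _ _

/-- The representation induced from a subgroup. -/
def indRep (H : Subgroup G) (V : FDRep ℂ ↥H) : FDRep ℂ G :=
  FDRep.of (Representation.coind H.subtype V.ρ)

lemma character_indRep (H : Subgroup G) (V : FDRep ℂ ↥H) :
    (indRep H V).character = indChar H V.character := by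
  classical
  have := Fintype.ofFinite G
  have := Fintype.ofFinite ↥H
  have hH : (Nat.card ↥H : ℂ) ≠ 0 := Nat.cast_ne_zero.2 Nat.card_pos.ne'
  let A : (G → V) →ₗ[ℂ] (G → V) := (Nat.card ↥H : ℂ)⁻¹ •
    ∑ h : ↥H, (V.ρ h).compLeft G ∘ₗ LinearMap.funLeft ℂ V (fun x : G => (h : G)⁻¹ * x)
  have hA (f : G → V) (x : G) :
      A f x = (Nat.card ↥H : ℂ)⁻¹ • ∑ h : ↥H, V.ρ h (f ((h : G)⁻¹ * x)) := by
    simp [A, LinearMap.funLeft_apply]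
  have hmem (f : G → V) : A f ∈ Representation.coindV H.subtype V.ρ := by
    intro k x
    rw [hA, hA, map_smul, map_sum, ← Equiv.sum_comp (Equiv.mulLeft k)]
    simp [mul_assoc]
  have hid (f : G → V) (hf : f ∈ Representation.coindV H.subtype V.ρ) : A f = f := by
    ext x
    have h (k : ↥H) : V.ρ k (f ((k : G)⁻¹ * x)) = f x := by
      rw [← hf k]; simp
    simp only [hA, h, Finset.sum_const, Finset.card_univ, Fintype.card_eq_nat_card]
    rw [← Nat.cast_smul_eq_nsmul ℂ, smul_smul, inv_mul_cancel₀ hH, one_smul]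
  let p := A.codRestrict _ hmem
  let i := (Representation.coindV H.subtype V.ρ).subtype
  ext g
  let R : (G → V) →ₗ[ℂ] (G → V) := LinearMap.funLeft ℂ V (fun x : G => x * g)
  have hfac : Representation.coind H.subtype V.ρ g = (p ∘ₗ R) ∘ₗ i := by
    ext f : 1
    apply Subtype.ext
    have : R f ∈ Representation.coindV H.subtype V.ρ :=
      (Representation.coind H.subtype V.ρ g f).2
    exact (hid _ this).symm
  have htr : (indRep H V).character g = LinearMap.trace ℂ (G → V) (A ∘ₗ R) := by
    change LinearMap.trace ℂ _ (Representation.coind H.subtype V.ρ g) = _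
    rw [hfac, LinearMap.trace_comp_comm']
    rfl
  have hdiag (x : G) : LinearMap.trace ℂ V (LinearMap.proj x ∘ₗ (A ∘ₗ R) ∘ₗ
      LinearMap.single ℂ (fun _ => V) x) =
      (Nat.card ↥H : ℂ)⁻¹ * extendZero H V.character (x * g * x⁻¹) := by
    have hsum : LinearMap.proj x ∘ₗ (A ∘ₗ R) ∘ₗ LinearMap.single ℂ (fun _ => V) x =
        (Nat.card ↥H : ℂ)⁻¹ • ∑ h : ↥H, if (h : G) = x * g * x⁻¹ then V.ρ h else 0 := by
      ext v
      have hx (h : ↥H) : (h : G)⁻¹ * x * g = x ↔ (h : G) = x * g * x⁻¹ := by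
        rw [mul_assoc, inv_mul_eq_iff_eq_mul, eq_mul_inv_iff_mul_eq, eq_comm]
      simp only [LinearMap.comp_apply, LinearMap.proj_apply, hA, LinearMap.smul_apply,
        LinearMap.sum_apply]
      congr 1
      refine Finset.sum_congr rfl fun h _ => ?_
      by_cases hh : (h : G) = x * g * x⁻¹
      · simp [R, LinearMap.funLeft_apply, (hx h).2 hh, if_pos hh]
      · simp [R, LinearMap.funLeft_apply, Pi.single_eq_of_ne (mt (hx h).1 hh), if_neg hh]
    rw [hsum, map_smul, map_sum, smul_eq_mul]
    congr 1
    by_cases hm : x * g * x⁻¹ ∈ H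
    · rw [Finset.sum_eq_single ⟨_, hm⟩]
      · simp only [if_true]
        exact (extendZero_coe H V.character ⟨_, hm⟩).symm
      · intro h _ hne
        rw [if_neg (fun hc => hne (Subtype.ext hc)), map_zero]
      · simp
    · rw [extendZero_of_notMem _ _ hm]
      refine Finset.sum_eq_zero fun h _ => ?_
      rw [if_neg (fun hc : (h : G) = x * g * x⁻¹ => hm (hc ▸ h.2)), map_zero]
  rw [htr, trace_pi, Finset.sum_congr rfl fun x _ => hdiag x, ← Finset.mul_sum, indChar_apply,
    ← Equiv.sum_comp (Equiv.inv G)]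
  simp

end Induction

section MemP

variable {G Q : Type} [Group G] [Finite G] [Group Q]

/-- The generators of dihedral type of `P_G` may be pulled back to `K ≤ G` along any surjective
homomorphism. -/
lemma memP_indChar_comp (K : Subgroup G) (φ : ↥K →* Q)
    (hφ : Function.Surjective φ) (τ : FDRep ℂ Q) (hdeg : τ.character 1 = 2)
    (N : Subgroup Q) [N.Normal]
    (hfac : ∀ n h : Q, n ∈ N → τ.character (n * h) = τ.character h)
    (hquot : Nonempty (Q ⧸ N ≃* Multiplicative (ZMod 2) × Multiplicative (ZMod 2)) ∨
      Nonempty (Q ⧸ N ≃* DihedralGroup 4) ∨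
      ∃ p : ℕ, p.Prime ∧ Odd p ∧ Nonempty (Q ⧸ N ≃* DihedralGroup p)) :
    MemP G (indChar K ((τ.character - 1 - detChar τ) ∘ φ)) := by
  let ψ := (QuotientGroup.mk' N).comp φ
  have hψ : Function.Surjective ψ := (QuotientGroup.mk'_surjective N).comp hφ
  let e : ↥K ⧸ ψ.ker ≃* Q ⧸ N := QuotientGroup.quotientKerEquivOfSurjective ψ hψ
  refine MemP.dihedralInd K (resRep φ τ) ?_ ψ.ker ?_ ?_
  · rw [character_resRep, Function.comp_apply, map_one, hdeg]
  · intro n h hn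
    have hn' : φ n ∈ N := (QuotientGroup.eq_one_iff (φ n)).1 hn
    rw [character_resRep, Function.comp_apply, map_mul, hfac _ _ hn', Function.comp_apply]
  · exact hquot.imp (Nonempty.map e.trans) (Or.imp (Nonempty.map e.trans)
      fun ⟨p, hp, hodd, h⟩ => ⟨p, hp, hodd, h.map e.trans⟩)

lemma MemP.indChar (H : Subgroup G) {ρ : ↥H → ℂ} (hρ : MemP ↥H ρ) :
    MemP G (Chars.indChar H ρ) := by
  induction hρ with
  | selfConj V W hdeg =>
    rw [indChar_add, indChar_star, indChar_sub, ← character_indRep, ← character_indRep]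
    refine MemP.selfConj _ _ ?_
    rw [character_indRep, character_indRep, indChar_one, indChar_one, hdeg]
  | dihedralInd K τ hdeg N hfac hquot =>
    rw [indChar_indChar]
    exact memP_indChar_comp _ (K.equivMapOfInjective H.subtype H.subtype_injective).symm.toMonoidHom
      (MulEquiv.surjective _) τ hdeg N hfac hquot
  | zero => rw [indChar_zero]; exact MemP.zero
  | add _ _ h₁ h₂ => rw [indChar_add]; exact h₁.add h₂
  | zsmul n _ h => rw [indChar_zsmul]; exact h.zsmul n

lemma MemP.comp [Finite Q] {π : G →* Q} (hπ : Function.Surjective π) {χ : Q → ℂ}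
    (hχ : MemP Q χ) : MemP G (χ ∘ π) := by
  induction hχ with
  | selfConj V W hdeg =>
    exact MemP.selfConj (resRep π V) (resRep π W) (by
      rw [character_resRep, character_resRep, Function.comp_apply, Function.comp_apply, map_one,
        hdeg])
  | dihedralInd H τ hdeg N hfac hquot =>
    rw [indChar_comp_of_surjective π hπ]
    exact memP_indChar_comp _ (π.subgroupComap H)
      (π.subgroupComap_surjective_of_surjective H hπ) τ hdeg N hfac hquot
  | zero => exact MemP.zero
  | add _ _ h₁ h₂ => exact h₁.add h₂
  | zsmul n _ h => exact h.zsmul n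

end MemP

section MemS

variable {G Q : Type} [Group G] [Group Q]

lemma permChar_comp_of_surjective {π : G →* Q} (hπ : Function.Surjective π) (H : Subgroup Q) :
    permChar H ∘ π = permChar (H.comap π) := by
  let e : G ⧸ H.comap π ≃ Q ⧸ H := Equiv.ofBijective
    (Quotient.map' π fun a b hab => by
      rw [QuotientGroup.leftRel_apply] at hab ⊢
      simpa using hab) <| by
    constructor
    · rintro ⟨a⟩ ⟨b⟩ hab
      have hab' : (π a : Q ⧸ H) = π b := hab
      refine QuotientGroup.eq.2 ?_
      simpa using QuotientGroup.eq.1 hab'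
    · rintro ⟨q⟩
      obtain ⟨a, rfl⟩ := hπ q
      exact ⟨QuotientGroup.mk a, rfl⟩
  have he (g : G) (x : G ⧸ H.comap π) : e (g • x) = π g • e x := by
    obtain ⟨a, rfl⟩ := QuotientGroup.mk_surjective x
    change ((π (g * a) : Q) : Q ⧸ H) = ((π g * π a : Q) : Q ⧸ H)
    rw [map_mul]
  ext g
  refine congrArg Nat.cast (Nat.card_congr (e.subtypeEquiv fun x => ?_)).symm
  rw [← he, e.apply_eq_iff_eq]

lemma MemS.comp {π : G →* Q} (hπ : Function.Surjective π) {χ : Q → ℂ} (hχ : MemS χ) :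
    MemS (χ ∘ π) := by
  obtain ⟨⟨k, Hs, ns, hχ⟩, hdeg, V, W, hVW, hdet⟩ := hχ
  refine ⟨⟨k, fun i => (Hs i).comap π, ns, ?_⟩, by simpa using hdeg,
    resRep π V, resRep π W, ?_, fun g => hdet (π g)⟩
  · rw [hχ]
    simp only [← permChar_comp_of_surjective hπ]
    rfl
  · rw [hVW]
    rfl

end MemS

end Chars

open Chars

/-- (1) If `H ≤ G` and `ρ ∈ P_H`, then `Ind_H^G ρ ∈ P_G`.
(2) If `N ⊴ G`, then inflation along `G → G/N` maps `S_{G/N}` into `S_G` and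
`P_{G/N}` into `P_G`. -/
theorem induction_preserves_P_and_inflation_preserves_S_and_P
    (G : Type) [Group G] [Finite G] :
    (∀ (H : Subgroup G) (ρ : ↥H → ℂ), MemP ↥H ρ → MemP G (indChar H ρ)) ∧
    (∀ (N : Subgroup G) [N.Normal],
      (∀ χ : G ⧸ N → ℂ, MemS χ → MemS (fun g : G => χ (QuotientGroup.mk g))) ∧
      (∀ χ : G ⧸ N → ℂ, MemP (G ⧸ N) χ → MemP G (fun g : G => χ (QuotientGroup.mk g)))) := by
  refine ⟨fun H ρ hρ => hρ.indChar H, fun N _ => ⟨fun χ hχ => ?_, fun χ hχ => ?_⟩⟩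
  · exact hχ.comp (QuotientGroup.mk'_surjective N)
  · exact hχ.comp (QuotientGroup.mk'_surjective N)
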